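/- Let f : ℝ → ℝ be continuous and suppose for every x ∈ ℝ there exists ε_x > 0 such that f(t₀) ≥ f(t₁) whenever x − ε_x ≤ t₀ < t₁ < x. Then f is nonincreasing on ℝ. -/

import Mathlib

theorem locally_nonincreasing_implies_antitone
    (f : ℝ → ℝ) (hf : Continuous f)
    (h : ∀ x : ℝ, ∃ ε > (0 : ℝ), ∀ t₀ t₁ : ℝ,
      x - ε ≤ t₀ → t₀ < t₁ → t₁ < x → f t₁ ≤ f t₀) :
    Antitone f := by
  intro a b hab
  have hclosed : IsClosed ({x | f b ≤ f x} ∩ Set.Icc a b) :=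
    (isClosed_le continuous_const hf).inter isClosed_Icc
  refine hclosed.mem_of_ge_of_forall_exists_lt (le_refl (f b)) hab ?_
  rintro x ⟨hx, hax, -⟩
  obtain ⟨ε, hε, hmono⟩ := h x
  have hlt : max a (x - ε) < x := max_lt hax (sub_lt_self x hε)
  have hle : f x ≤ f (max a (x - ε)) := by
    refine le_of_tendsto (hf.continuousWithinAt (s := Set.Iio x) (x := x)) ?_
    filter_upwards [Ioo_mem_nhdsLT hlt] with t ht
    exact hmono _ t (le_max_right _ _) ht.1 ht.2
  exact ⟨max a (x - ε), le_trans hx hle, le_max_left _ _, hlt⟩
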